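/- Let α be a fixed-point-free involution on a set of cardinality 2e and β a permutation with |β| cycles such that ⟨α, β⟩ is transitive. Then the integer 2 − (|β| − |α| + |(αβ)⁻¹|) is even and nonnegative; in particular g := (2 − (|β| − |α| + |(αβ)⁻¹|))/2 is a nonnegative integer. -/

import Mathlib

/-- The number of cycles of a permutation `σ` on a finite set, fixed points
included as trivial cycles (= number of orbits of the group generated by `σ`). -/
def cycleCount {X : Type*} [Fintype X] [DecidableEq X] (σ : Equiv.Perm X) : ℕ :=
  (Fintype.card X - σ.cycleType.sum) + σ.cycleType.card

open Equiv.Perm in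
/-- The number of cycles is at most the number of classes of `SameCycle`. -/
theorem cycleCount_le_card_quotient {X : Type*} [Fintype X] [DecidableEq X] (σ : Equiv.Perm X) :
    cycleCount σ ≤ Nat.card (Quotient (SameCycle.setoid σ)) := by
  have hrep : ∀ c : σ.cycleFactorsFinset, ∃ x, x ∈ c.1.support := fun c =>
    ((mem_cycleFactorsFinset_iff.mp c.2).1.nonempty_support)
  choose r hr using hrep
  have hrσ : ∀ c, r c ∈ σ.support := fun c =>
    mem_cycleFactorsFinset_support_le c.2 (hr c)
  let F : ((σ.supportᶜ : Finset X) : Type _) ⊕ σ.cycleFactorsFinset →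
      Quotient (SameCycle.setoid σ) :=
    Sum.elim (fun x => Quotient.mk _ x.1) (fun c => Quotient.mk _ (r c))
  have hfix : ∀ x : ((σ.supportᶜ : Finset X) : Type _), σ x.1 = x.1 := fun x =>
    notMem_support.mp (Finset.mem_compl.mp x.2)
  have hF : Function.Injective F := by
    rintro (x | c) (y | d) h
    · have h' : SameCycle σ x.1 y.1 := Quotient.exact h
      exact congrArg _ (Subtype.ext (h'.eq_of_left (hfix x)))
    · have h' : SameCycle σ x.1 (r d) := Quotient.exact h
      exact absurd (h'.eq_of_left (hfix x) ▸ hrσ d) (Finset.mem_compl.mp x.2)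
    · have h' : SameCycle σ (r c) y.1 := Quotient.exact h
      exact absurd (h'.eq_of_right (hfix y) ▸ hrσ c) (Finset.mem_compl.mp y.2)
    · have h' : SameCycle σ (r c) (r d) := Quotient.exact h
      refine congrArg _ (Subtype.ext ?_)
      rw [cycle_is_cycleOf (hr c) c.2, cycle_is_cycleOf (hr d) d.2, h'.cycleOf_eq]
  have := Nat.card_le_card_of_injective F hF
  rw [Nat.card_sum, Nat.card_eq_fintype_card, Nat.card_eq_fintype_card, Fintype.card_coe,
    Fintype.card_coe, Finset.card_compl] at this
  rw [cycleCount, sum_cycleType, cycleType_def, Multiset.card_map]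
  exact this

open Equiv.Perm in
/-- The image of `f ↦ f - f ∘ σ` has dimension at most the number of points minus
the number of cycles of `σ`. -/
theorem finrank_range_sub_funLeft_add_cycleCount_le {X : Type*} [Fintype X] [DecidableEq X]
    (σ : Equiv.Perm X) :
    Module.finrank ℚ (LinearMap.range (LinearMap.id - LinearMap.funLeft ℚ ℚ σ)) + cycleCount σ
      ≤ Fintype.card X := by
  classical
  have hrk := (LinearMap.id - LinearMap.funLeft ℚ ℚ σ).finrank_range_add_finrank_ker
  rw [Module.finrank_fintype_fun_eq_card] at hrk
  let Q := Quotient (SameCycle.setoid σ)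
  let π : X → Q := Quotient.mk _
  have hinj : Function.Injective (LinearMap.funLeft ℚ ℚ π) :=
    LinearMap.funLeft_injective_of_surjective ℚ ℚ π Quotient.mk_surjective
  have hle : LinearMap.range (LinearMap.funLeft ℚ ℚ π) ≤
      LinearMap.ker (LinearMap.id - LinearMap.funLeft ℚ ℚ σ) := by
    rintro _ ⟨f, rfl⟩
    rw [LinearMap.mem_ker, LinearMap.sub_apply, sub_eq_zero]
    funext x
    exact congrArg f (Quotient.sound (sameCycle_apply_right.mpr (SameCycle.refl σ x)))
  have hcard := Submodule.finrank_mono hle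
  rw [LinearMap.finrank_range_of_inj hinj, Module.finrank_fintype_fun_eq_card,
    ← Nat.card_eq_fintype_card] at hcard
  have := cycleCount_le_card_quotient σ
  change cycleCount σ ≤ Nat.card Q at this
  omega

/-- A function invariant under a transitive pair of permutations is constant. -/
theorem finrank_invariants_le_one {X : Type*} [Fintype X] (α β : Equiv.Perm X)
    (htrans : ∀ x y : X, ∃ g ∈ Subgroup.closure {α, β}, g x = y) (K : Submodule ℚ (X → ℚ))
    (hα : ∀ f ∈ K, f ∘ α = f) (hβ : ∀ f ∈ K, f ∘ β = f) :
    Module.finrank ℚ K ≤ 1 := by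
  have hle : K ≤ Submodule.span ℚ {(fun _ => 1 : X → ℚ)} := by
    intro f hf
    have hinv : ∀ g ∈ Subgroup.closure {α, β}, f ∘ g = f := by
      intro g hg
      induction hg using Subgroup.closure_induction with
      | mem g hg =>
        rcases hg with rfl | rfl
        exacts [hα f hf, hβ f hf]
      | one => rfl
      | mul g h _ _ ihg ihh => rw [Equiv.Perm.coe_mul, ← Function.comp_assoc, ihg, ihh]
      | inv g _ ih =>
        funext x
        simpa using (congrFun ih (g⁻¹ x)).symm
    rcases isEmpty_or_nonempty X with _ | ⟨⟨x₀⟩⟩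
    · rw [Subsingleton.elim f 0]
      exact zero_mem _
    · refine Submodule.mem_span_singleton.mpr ⟨f x₀, funext fun y => ?_⟩
      obtain ⟨g, hg, rfl⟩ := htrans x₀ y
      simpa using (congrFun (hinv g hg) x₀).symm
  exact (Submodule.finrank_mono hle).trans (by
    simpa using finrank_span_le_card ({(fun _ => 1 : X → ℚ)} : Set (X → ℚ)))

/-- A subspace containing all `f - f ∘ α` and `f - f ∘ β` for a transitive pair has
codimension at most one. -/
theorem card_le_finrank_add_one {X : Type*} [Fintype X] [DecidableEq X] (α β : Equiv.Perm X)
    (htrans : ∀ x y : X, ∃ g ∈ Subgroup.closure {α, β}, g x = y) (P : Submodule ℚ (X → ℚ))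
    (hα : ∀ f : X → ℚ, f - f ∘ α ∈ P) (hβ : ∀ f : X → ℚ, f - f ∘ β ∈ P) :
    Fintype.card X ≤ Module.finrank ℚ P + 1 := by
  have hmem : ∀ g ∈ Subgroup.closure {α, β}, ∀ f : X → ℚ, f - f ∘ g ∈ P := by
    intro g hg
    induction hg using Subgroup.closure_induction with
    | mem g hg =>
      rcases hg with rfl | rfl
      exacts [hα, hβ]
    | one => intro f; simp
    | mul g h _ _ ihg ihh =>
      intro f
      simpa [Function.comp_assoc] using add_mem (ihg f) (ihh (f ∘ g))
    | inv g _ ih =>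
      intro f
      have h : (f ∘ ⇑g⁻¹) ∘ ⇑g = f := by funext x; simp
      have h' := neg_mem (ih (f ∘ ⇑g⁻¹))
      rwa [h, neg_sub] at h'
  rcases isEmpty_or_nonempty X with _ | ⟨⟨x₀⟩⟩
  · simp
  · have htop : P ⊔ Submodule.span ℚ {Pi.single x₀ (1 : ℚ)} = ⊤ := by
      rw [eq_top_iff, ← (Pi.basisFun ℚ X).span_eq, Submodule.span_le]
      rintro _ ⟨y, rfl⟩
      obtain ⟨g, hg, rfl⟩ := htrans x₀ y
      have h : (Pi.single (g x₀) (1 : ℚ) : X → ℚ) ∘ g = Pi.single x₀ 1 := by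
        funext x
        simp [Pi.single_apply]
      have h₁ := hmem g hg (Pi.single (g x₀) 1)
      rw [h] at h₁
      have h₂ := Submodule.add_mem_sup h₁ (Submodule.mem_span_singleton_self (R := ℚ)
        (Pi.single x₀ (1 : ℚ) : X → ℚ))
      rw [sub_add_cancel] at h₂
      simpa only [Pi.basisFun_apply, SetLike.mem_coe] using h₂
    have h := Submodule.finrank_add_le_finrank_add_finrank P
      (Submodule.span ℚ {Pi.single x₀ (1 : ℚ)})
    rw [htop, finrank_top, Module.finrank_fintype_fun_eq_card] at h
    have h₁ : Module.finrank ℚ (Submodule.span ℚ {(Pi.single x₀ (1 : ℚ) : X → ℚ)}) ≤ 1 := by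
      simpa using finrank_span_le_card ({(Pi.single x₀ (1 : ℚ))} : Set (X → ℚ))
    omega

/-- Ree's inequality for a transitive pair of permutations, by Scott's dimension count. -/
theorem cycleCount_add_add_le {X : Type*} [Fintype X] [DecidableEq X] (α β : Equiv.Perm X)
    (htrans : ∀ x y : X, ∃ g ∈ Subgroup.closure {α, β}, g x = y) :
    cycleCount α + cycleCount β + cycleCount (α * β) ≤ Fintype.card X + 2 := by
  let L : Equiv.Perm X → (X → ℚ) →ₗ[ℚ] (X → ℚ) := fun σ => LinearMap.funLeft ℚ ℚ σ
  let D : Equiv.Perm X → (X → ℚ) →ₗ[ℚ] (X → ℚ) := fun σ => LinearMap.id - L σ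
  have hD : ∀ σ f, D σ f = f - f ∘ σ := fun _ _ => rfl
  let Φ : (X → ℚ) →ₗ[ℚ] LinearMap.range (D α) × LinearMap.range (D β) ×
      LinearMap.range (D (α * β)) :=
    (D α).rangeRestrict.prod ((D β).rangeRestrict.prod (D (α * β)).rangeRestrict)
  let Ψ : LinearMap.range (D α) × LinearMap.range (D β) × LinearMap.range (D (α * β))
      →ₗ[ℚ] (X → ℚ) :=
    ((L β).comp (LinearMap.range (D α)).subtype).coprod
      ((LinearMap.range (D β)).subtype.coprod (-(LinearMap.range (D (α * β))).subtype))
  have hΨ : ∀ u v w, Ψ (u, v, w) = u.1 ∘ β + (v.1 + -w.1) := fun _ _ _ => rfl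
  have hcomp : LinearMap.range Φ ≤ LinearMap.ker Ψ := by
    rintro _ ⟨f, rfl⟩
    change (f - f ∘ α) ∘ β + ((f - f ∘ β) + -(f - f ∘ (α * β))) = 0
    funext x
    simp
  have hker : Module.finrank ℚ (LinearMap.ker Φ) ≤ 1 := by
    refine finrank_invariants_le_one α β htrans _ (fun f hf => ?_) fun f hf => ?_
    · have h := congrArg (fun p => (p.1 : X → ℚ)) (LinearMap.mem_ker.mp hf)
      exact (sub_eq_zero.mp h).symm
    · have h := congrArg (fun p => (p.2.1 : X → ℚ)) (LinearMap.mem_ker.mp hf)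
      exact (sub_eq_zero.mp h).symm
  have hβ : ∀ f : X → ℚ, f - f ∘ β ∈ LinearMap.range Ψ := fun f =>
    ⟨(0, ⟨D β f, f, rfl⟩, 0), by rw [hΨ]; funext x; simp [hD]⟩
  have hα : ∀ f : X → ℚ, f - f ∘ α ∈ LinearMap.range Ψ := fun f =>
    ⟨(⟨D α f, f, rfl⟩, ⟨D β (D α f), D α f, rfl⟩, 0), by rw [hΨ]; funext x; simp [hD]⟩
  have hrange := card_le_finrank_add_one α β htrans _ hα hβ
  have h₁ := Φ.finrank_range_add_finrank_ker
  have h₂ := Ψ.finrank_range_add_finrank_ker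
  rw [Module.finrank_fintype_fun_eq_card] at h₁
  rw [Module.finrank_prod, Module.finrank_prod] at h₂
  have h₃ := Submodule.finrank_mono hcomp
  have hdα := finrank_range_sub_funLeft_add_cycleCount_le α
  have hdβ := finrank_range_sub_funLeft_add_cycleCount_le β
  have hdαβ := finrank_range_sub_funLeft_add_cycleCount_le (α * β)
  change Module.finrank ℚ (LinearMap.range (D α)) + _ ≤ _ at hdα
  change Module.finrank ℚ (LinearMap.range (D β)) + _ ≤ _ at hdβ
  change Module.finrank ℚ (LinearMap.range (D (α * β))) + _ ≤ _ at hdαβ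
  omega

theorem sign_eq_neg_one_pow_card_add_cycleCount {X : Type*} [Fintype X] [DecidableEq X]
    (σ : Equiv.Perm X) :
    Equiv.Perm.sign σ = (-1) ^ (Fintype.card X + cycleCount σ) := by
  rw [Equiv.Perm.sign_of_cycleType]
  refine (neg_one_pow_congr ?_)
  have := σ.sum_cycleType_le
  rw [cycleCount, Nat.even_iff, Nat.even_iff]
  omega

theorem even_card_add_cycleCount {X : Type*} [Fintype X] [DecidableEq X] (α β : Equiv.Perm X) :
    Even (Fintype.card X + (cycleCount α + cycleCount β + cycleCount (α * β))) := by
  have h := map_mul Equiv.Perm.sign α β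
  simp only [sign_eq_neg_one_pow_card_add_cycleCount, ← pow_add] at h
  have h' := congrArg (fun u : ℤˣ => (u : ℤ)) h
  simp only [Units.val_pow_eq_pow_val, Units.val_neg, Units.val_one] at h'
  rcases Nat.even_or_odd (Fintype.card X + cycleCount (α * β)) with h₁ | h₁ <;>
  rcases Nat.even_or_odd (Fintype.card X + cycleCount α + (Fintype.card X + cycleCount β))
    with h₂ | h₂ <;>
  first
  | (rw [h₁.neg_one_pow, h₂.neg_one_pow] at h'; omega)
  | grind

theorem two_mul_cycleCount_of_sq_eq_one {X : Type*} [Fintype X] [DecidableEq X]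
    (α : Equiv.Perm X) (hinv : α ^ 2 = 1) (hfpf : ∀ x : X, α x ≠ x) :
    2 * cycleCount α = Fintype.card X := by
  have hsupp : α.support = Finset.univ := by
    ext x
    simp [hfpf x]
  have hsum := α.sum_cycleType
  rw [hsupp, Finset.card_univ] at hsum
  have hrep := congrArg Multiset.sum (Equiv.Perm.cycleType_of_pow_prime_eq_one hinv)
  rw [Multiset.sum_replicate, smul_eq_mul] at hrep
  rw [cycleCount]
  omega

/-- For α a fixed-point-free involution on 2e points and β with ⟨α, β⟩
transitive, 2 − (|β| − |α| + |(αβ)⁻¹|) is even and nonnegative; i.e. the genus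
g = (2 − (|β| − |α| + |(αβ)⁻¹|))/2 is a nonnegative integer. -/
theorem genus_nonneg_integer {X : Type*} [Fintype X] [DecidableEq X]
    (e : ℕ) (hcard : Fintype.card X = 2 * e) (α β : Equiv.Perm X)
    (hinv : α ^ 2 = 1) (hfpf : ∀ x : X, α x ≠ x)
    (htrans : ∀ x y : X, ∃ g ∈ Subgroup.closure {α, β}, g x = y) :
    ∃ g : ℕ, (2 : ℤ) - ((cycleCount β : ℤ) - cycleCount α
      + cycleCount ((α * β)⁻¹)) = 2 * g := by
  have hα := two_mul_cycleCount_of_sq_eq_one α hinv hfpf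
  have hle := cycleCount_add_add_le α β htrans
  obtain ⟨k, hk⟩ := even_card_add_cycleCount α β
  have hcc : cycleCount ((α * β)⁻¹) = cycleCount (α * β) := by
    rw [cycleCount, cycleCount, Equiv.Perm.cycleType_inv]
  rw [hcc]
  refine ⟨(2 + cycleCount α - cycleCount β - cycleCount (α * β)) / 2, ?_⟩
  omega
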